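/- Let p₀, p₁ : R → (0,1) satisfy p₁ ≥ p₀ pointwise and μ·𝐩₁ > μ·𝐩₀ = 1/2. For ε ∈ (0,1], let K̂_ε be the 2N×2N block matrix with blocks ((1−ε)K, εK; 0, K), let 𝐩̂ = (𝐩₁; 𝐩₀), and η̂_ε = ((1−ε)η, εη), and set δ̂_ε = δ(𝐩̂, K̂_ε, η̂_ε) where δ(𝐩,K,η) = 2(η·𝐫(𝐩,K))/ν(𝐩,K). Then δ̂_ε = δ(𝐩₀,K,η) + 4 η·(Σ_{j=1}^{∞} (1−ε)^j K^{j−1}(𝐩₁−𝐩₀)) / ν(𝐩₀,K). In particular, ε ↦ δ̂_ε is continuous and strictly decreasing on (0,1], equals δ(𝐩₀,K,η) at ε = 1, and δ̂_ε → ∞ as ε ↓ 0. -/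

import Mathlib

open MeasureTheory Filter Set Matrix ProbabilityTheory
open scoped Classical

noncomputable section

/-- `K` is a (row-)stochastic matrix. -/
def IsStochastic {n : Type*} [Fintype n] (K : Matrix n n ℝ) : Prop :=
  (∀ i j, 0 ≤ K i j) ∧ ∀ i, ∑ j, K i j = 1

/-- `v` is a probability (row) vector. -/
def IsProbVec {n : Type*} [Fintype n] (v : n → ℝ) : Prop :=
  (∀ i, 0 ≤ v i) ∧ ∑ i, v i = 1

/-- `μ` is a stationary distribution for `K`, i.e. `μ K = μ`. -/
def IsStationaryDist {n : Type*} [Fintype n] (K : Matrix n n ℝ) (μ : n → ℝ) : Prop :=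
  IsProbVec μ ∧ Matrix.vecMul μ K = μ

/-- `μ` is the unique stationary distribution of `K` (equivalent, for a finite chain, to `K`
having a unique closed irreducible subset). -/
def HasUniqueStationaryDist {n : Type*} [Fintype n] (K : Matrix n n ℝ) (μ : n → ℝ) : Prop :=
  IsStationaryDist K μ ∧ ∀ μ' : n → ℝ, IsStationaryDist K μ' → μ' = μ

/-- The vector `𝐫 = (I − K + 2(𝟏−𝐩)μD_{1−p}K)⁻¹ 𝐩 − 𝟏` (critical case `p̄ = 1/2`). -/
def rvec {n : Type*} [Fintype n] [DecidableEq n] (K : Matrix n n ℝ) (μ p : n → ℝ) : n → ℝ :=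
  Matrix.mulVec
    (1 - K + (2 : ℝ) •
        Matrix.vecMulVec (fun i => 1 - p i)
          (Matrix.vecMul μ (Matrix.diagonal (fun i => 1 - p i) * K)))⁻¹ p
    - 1

/-- The parameter `ν = 2 + 4 μ D_p K 𝐫` (critical case `p̄ = 1/2`). -/
def nuVal {n : Type*} [Fintype n] [DecidableEq n] (K : Matrix n n ℝ) (μ p : n → ℝ) : ℝ :=
  2 + 4 * ∑ i, Matrix.vecMul μ (Matrix.diagonal p * K) i * rvec K μ p i

/-- The parameter `δ = 2 (η·𝐫) / ν` (critical case `p̄ = 1/2`). -/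
def deltaVal {n : Type*} [Fintype n] [DecidableEq n] (K : Matrix n n ℝ) (μ p η : n → ℝ) : ℝ :=
  2 * (∑ i, η i * rvec K μ p i) / nuVal K μ p

/-- The parameter `δ̂_ε = δ(𝐩̂, K̂_ε, η̂_ε)` of the coupled critical cookie environment, where
`K̂_ε` is the `2N×2N` block matrix `((1−ε)K, εK; 0, K)`, `𝐩̂ = (𝐩₁; 𝐩₀)` and
`η̂_ε = ((1−ε)η, εη)`; the stationary distribution of `K̂_ε` is `μ̂ = (0, μ)`. -/
def deltaHat {N : ℕ} (K : Matrix (Fin N) (Fin N) ℝ) (μ p₀ p₁ η : Fin N → ℝ) (ε : ℝ) : ℝ :=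
  deltaVal (Matrix.fromBlocks ((1 - ε) • K) (ε • K) 0 K)
    (Sum.elim (0 : Fin N → ℝ) μ) (Sum.elim p₁ p₀)
    (Sum.elim ((1 - ε) • η) (ε • η))

/-- The matrix `I − K + 2(𝟏−𝐩)μD_{1−p}K` inverted in the definition of `rvec`. -/
def critMatrix {n : Type*} [Fintype n] [DecidableEq n] (K : Matrix n n ℝ) (μ p : n → ℝ) :
    Matrix n n ℝ :=
  1 - K + (2 : ℝ) •
    Matrix.vecMulVec (fun i => 1 - p i)
      (Matrix.vecMul μ (Matrix.diagonal (fun i => 1 - p i) * K))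

section Stochastic

variable {n : Type*} [Fintype n] {K : Matrix n n ℝ}

lemma IsStochastic.mulVec_one (hK : IsStochastic K) : K *ᵥ 1 = 1 := by
  ext i
  simpa [mulVec, dotProduct] using hK.2 i

lemma IsStochastic.sum_vecMul (hK : IsStochastic K) (v : n → ℝ) :
    ∑ j, (v ᵥ* K) j = ∑ i, v i := by
  have h := dotProduct_mulVec v K 1
  rw [hK.mulVec_one] at h
  simpa [dotProduct] using h.symm

lemma IsStochastic.abs_mulVec_le (hK : IsStochastic K) {f : n → ℝ} {C : ℝ}
    (hf : ∀ i, |f i| ≤ C) (i : n) : |(K *ᵥ f) i| ≤ C := by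
  calc |(K *ᵥ f) i| ≤ ∑ j, |K i j * f j| := Finset.abs_sum_le_sum_abs _ _
    _ ≤ ∑ j, K i j * C := by
        refine Finset.sum_le_sum fun j _ => ?_
        rw [abs_mul, abs_of_nonneg (hK.1 i j)]
        exact mul_le_mul_of_nonneg_left (hf j) (hK.1 i j)
    _ = C := by rw [← Finset.sum_mul, hK.2 i, one_mul]

lemma IsStochastic.mulVec_nonneg (hK : IsStochastic K) {f : n → ℝ}
    (hf : ∀ i, 0 ≤ f i) (i : n) : 0 ≤ (K *ᵥ f) i :=
  Finset.sum_nonneg fun j _ => mul_nonneg (hK.1 i j) (hf j)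

lemma IsStochastic.sq_mulVec_le (hK : IsStochastic K) (r : n → ℝ) (i : n) :
    (K *ᵥ r) i ^ 2 ≤ (K *ᵥ fun j => r j ^ 2) i := by
  have hnonneg : 0 ≤ ∑ j, K i j * (r j - (K *ᵥ r) i) ^ 2 :=
    Finset.sum_nonneg fun j _ => mul_nonneg (hK.1 i j) (sq_nonneg _)
  set y := (K *ᵥ r) i with hy
  have hterm : ∀ j, K i j * (r j - y) ^ 2
      = K i j * r j ^ 2 - 2 * y * (K i j * r j) + y ^ 2 * K i j := fun j => by ring
  simp_rw [hterm] at hnonneg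
  rw [Finset.sum_add_distrib, Finset.sum_sub_distrib, ← Finset.mul_sum, ← Finset.mul_sum,
    hK.2 i, show ∑ j, K i j * r j = y from rfl] at hnonneg
  change y ^ 2 ≤ ∑ j, K i j * r j ^ 2
  linarith

variable [DecidableEq n]

lemma IsStochastic.abs_pow_mulVec_le (hK : IsStochastic K) {f : n → ℝ} {C : ℝ}
    (hf : ∀ i, |f i| ≤ C) (j : ℕ) : ∀ i, |((K ^ j) *ᵥ f) i| ≤ C := by
  induction j with
  | zero => simpa using hf
  | succ j ih =>
    intro i
    rw [pow_succ', ← mulVec_mulVec]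
    exact hK.abs_mulVec_le ih i

lemma IsStochastic.pow_mulVec_nonneg (hK : IsStochastic K) {f : n → ℝ}
    (hf : ∀ i, 0 ≤ f i) (j : ℕ) : ∀ i, 0 ≤ ((K ^ j) *ᵥ f) i := by
  induction j with
  | zero => simpa using hf
  | succ j ih =>
    intro i
    rw [pow_succ', ← mulVec_mulVec]
    exact hK.mulVec_nonneg ih i

lemma IsStochastic.pow_mulVec_one (hK : IsStochastic K) (j : ℕ) : (K ^ j) *ᵥ 1 = 1 := by
  induction j with
  | zero => simp
  | succ j ih => rw [pow_succ', ← mulVec_mulVec, ih, hK.mulVec_one]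

lemma IsStochastic.summable_resolvent (hK : IsStochastic K) {t : ℝ} (ht0 : 0 ≤ t) (ht1 : t < 1)
    (f : n → ℝ) (i : n) : Summable fun j : ℕ => t ^ j * ((K ^ j) *ᵥ f) i := by
  refine Summable.of_norm_bounded
    ((summable_geometric_of_lt_one ht0 ht1).mul_right ‖f‖) fun j => ?_
  rw [norm_mul, norm_pow, Real.norm_of_nonneg ht0]
  exact mul_le_mul_of_nonneg_left (hK.abs_pow_mulVec_le (fun i => norm_le_pi_norm f i) j i)
    (pow_nonneg ht0 j)

lemma IsStochastic.resolvent_eq (hK : IsStochastic K) {t : ℝ} (ht0 : 0 ≤ t) (ht1 : t < 1)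
    (f : n → ℝ) :
    (1 - t • K) *ᵥ (fun i => ∑' j : ℕ, t ^ j * ((K ^ j) *ᵥ f) i) = f := by
  have hs := hK.summable_resolvent ht0 ht1 f
  ext i
  have h1 : (K *ᵥ fun i => ∑' j : ℕ, t ^ j * ((K ^ j) *ᵥ f) i) i
      = ∑' j : ℕ, t ^ j * ((K ^ (j + 1)) *ᵥ f) i := by
    change ∑ k, K i k * ∑' j : ℕ, t ^ j * ((K ^ j) *ᵥ f) k = _
    simp_rw [← tsum_mul_left]
    rw [← Summable.tsum_finsetSum fun k _ => (hs k).mul_left _]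
    refine tsum_congr fun j => ?_
    have := congrFun (mulVec_mulVec f K (K ^ j)) i
    rw [← pow_succ'] at this
    rw [← this, mulVec, dotProduct, Finset.mul_sum]
    refine Finset.sum_congr rfl fun k _ => ?_
    exact mul_left_comm _ _ _
  rw [sub_mulVec, one_mulVec, smul_mulVec, Pi.sub_apply, Pi.smul_apply, h1, smul_eq_mul,
    ← tsum_mul_left, (hs i).tsum_eq_zero_add]
  simp [pow_succ', mul_assoc]

lemma IsStochastic.det_one_sub_smul_ne_zero (hK : IsStochastic K) {t : ℝ} (ht0 : 0 ≤ t)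
    (ht1 : t < 1) : (1 - t • K).det ≠ 0 := by
  refine det_ne_zero_of_sum_row_lt_diag fun k => ?_
  have hrow := Finset.add_sum_erase Finset.univ (K k) (Finset.mem_univ k)
  rw [hK.2 k] at hrow
  have hoff : ∑ j ∈ Finset.univ.erase k, ‖(1 - t • K) k j‖
      = t * ∑ j ∈ Finset.univ.erase k, K k j := by
    rw [Finset.mul_sum]
    refine Finset.sum_congr rfl fun j hj => ?_
    simp [Matrix.one_apply_ne (Finset.ne_of_mem_erase hj).symm, abs_of_nonneg ht0,
      abs_of_nonneg (hK.1 k j)]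
  have hdiag : (1 - t • K) k k = 1 - t * K k k := by simp
  rw [hoff, hdiag, Real.norm_eq_abs]
  refine lt_of_lt_of_le ?_ (le_abs_self _)
  rw [← eq_sub_iff_add_eq'] at hrow
  rw [hrow]
  linarith

end Stochastic

section Stationary

variable {n : Type*} [Fintype n] {K : Matrix n n ℝ} {μ : n → ℝ}

lemma HasUniqueStationaryDist.eq_smul_of_nonneg (hμ : HasUniqueStationaryDist K μ) {w : n → ℝ}
    (hw : ∀ i, 0 ≤ w i) (hwK : w ᵥ* K = w) : w = (∑ i, w i) • μ := by
  rcases eq_or_ne (∑ i, w i) 0 with h0 | h0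
  · rw [h0, zero_smul]
    ext i
    exact (Finset.sum_eq_zero_iff_of_nonneg fun i _ => hw i).1 h0 i (Finset.mem_univ i)
  · have hstat : IsStationaryDist K ((∑ i, w i)⁻¹ • w) := by
      refine ⟨⟨fun i => ?_, ?_⟩, ?_⟩
      · exact mul_nonneg (inv_nonneg.2 (Finset.sum_nonneg fun i _ => hw i)) (hw i)
      · simp only [Pi.smul_apply, smul_eq_mul, ← Finset.mul_sum]
        exact inv_mul_cancel₀ h0
      · rw [smul_vecMul, hwK]
    rw [← hμ.2 _ hstat, smul_inv_smul₀ h0]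

lemma IsStochastic.abs_vecMul_eq (hK : IsStochastic K) {v : n → ℝ} (hv : v ᵥ* K = v) :
    (fun i => |v i|) ᵥ* K = fun i => |v i| := by
  have hle : ∀ j ∈ Finset.univ, |v j| ≤ ((fun i => |v i|) ᵥ* K) j := by
    intro j _
    calc |v j| = |(v ᵥ* K) j| := by rw [hv]
      _ ≤ ∑ i, |v i * K i j| := Finset.abs_sum_le_sum_abs _ _
      _ = ((fun i => |v i|) ᵥ* K) j := by
        refine Finset.sum_congr rfl fun i _ => ?_
        rw [abs_mul, abs_of_nonneg (hK.1 i j)]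
  ext j
  exact ((Finset.sum_eq_sum_iff_of_le hle).1 (hK.sum_vecMul _).symm j (Finset.mem_univ j)).symm

lemma HasUniqueStationaryDist.exists_eq_smul (hμ : HasUniqueStationaryDist K μ)
    (hK : IsStochastic K) {v : n → ℝ} (hv : v ᵥ* K = v) : ∃ c : ℝ, v = c • μ := by
  have habs := hK.abs_vecMul_eq hv
  have h1 := hμ.eq_smul_of_nonneg (fun i => abs_nonneg (v i)) habs
  have h2 := hμ.eq_smul_of_nonneg (w := (fun i => |v i|) - v)
    (fun i => sub_nonneg.2 (le_abs_self _)) (by rw [sub_vecMul, habs, hv])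
  refine ⟨∑ i, |v i| - ∑ i, ((fun i => |v i|) - v) i, ?_⟩
  rw [sub_smul, ← h1, ← h2]
  abel

lemma IsStationaryDist.sum_mul_mulVec (hμ : IsStationaryDist K μ) (x : n → ℝ) :
    ∑ i, μ i * (K *ᵥ x) i = ∑ i, μ i * x i := by
  have h := dotProduct_mulVec μ K x
  rwa [hμ.2] at h

lemma IsStationaryDist.sum_mul_one_sub {p : n → ℝ} (hμ : IsStationaryDist K μ)
    (hcrit : ∑ i, μ i * p i = 1 / 2) : ∑ i, μ i * (1 - p i) = 1 / 2 := by
  simp only [mul_sub, mul_one, Finset.sum_sub_distrib, hμ.1.2, hcrit]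
  norm_num

end Stationary

section CritMatrix

variable {n : Type*} [Fintype n] [DecidableEq n] {K : Matrix n n ℝ} {μ p : n → ℝ}

lemma rvec_eq (K : Matrix n n ℝ) (μ p : n → ℝ) :
    rvec K μ p = (critMatrix K μ p)⁻¹ *ᵥ p - 1 := rfl

lemma dotProduct_diagonal_mul_mulVec (μ a x : n → ℝ) (K : Matrix n n ℝ) :
    (μ ᵥ* (diagonal a * K)) ⬝ᵥ x = ∑ i, μ i * a i * (K *ᵥ x) i := by
  rw [← dotProduct_mulVec, ← mulVec_mulVec, dotProduct]
  simp [mulVec_diagonal, mul_assoc]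

lemma critMatrix_mulVec (K : Matrix n n ℝ) (μ p x : n → ℝ) :
    critMatrix K μ p *ᵥ x = x - K *ᵥ x +
      (2 * ∑ i, μ i * (1 - p i) * (K *ᵥ x) i) • (fun i => 1 - p i) := by
  rw [critMatrix, add_mulVec, sub_mulVec, one_mulVec, smul_mulVec, vecMulVec_mulVec,
    dotProduct_diagonal_mul_mulVec, op_smul_eq_smul, smul_smul]

lemma rvec_eq_of_mulVec_eq (hA : IsUnit (critMatrix K μ p)) {x : n → ℝ}
    (hx : critMatrix K μ p *ᵥ x = p) : rvec K μ p = x - 1 := by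
  have hdet := (Matrix.isUnit_iff_isUnit_det _).1 hA
  rw [rvec_eq]
  nth_rewrite 2 [← hx]
  rw [mulVec_mulVec, nonsing_inv_mul _ hdet, one_mulVec]

lemma isUnit_critMatrix (hK : IsStochastic K) (hμ : HasUniqueStationaryDist K μ)
    (hcrit : ∑ i, μ i * p i = 1 / 2) : IsUnit (critMatrix K μ p) := by
  have hhalf := hμ.1.sum_mul_one_sub hcrit
  rw [← vecMul_injective_iff_isUnit, ← coe_vecMulLinear, injective_iff_map_eq_zero]
  intro v hv
  change v ᵥ* critMatrix K μ p = 0 at hv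
  have hv0 : v ⬝ᵥ (fun i => 1 - p i) = 0 := by
    have h := dotProduct_mulVec v (critMatrix K μ p) 1
    rw [hv, critMatrix_mulVec, hK.mulVec_one] at h
    simpa [hhalf] using h
  have hvK : v ᵥ* K = v := by
    rw [critMatrix, vecMul_add, vecMul_sub, vecMul_one, vecMul_smul, vecMul_vecMulVec, hv0,
      zero_smul, smul_zero, add_zero, sub_eq_zero] at hv
    exact hv.symm
  obtain ⟨c, rfl⟩ := hμ.exists_eq_smul hK hvK
  have hc : c * (1 / 2) = 0 := by
    rw [← hhalf, ← hv0, smul_dotProduct]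
    rfl
  have : c = 0 := by linarith
  simp [this]

lemma exists_critMatrix_mulVec_eq (hA : IsUnit (critMatrix K μ p)) (q : n → ℝ) :
    ∃ x, critMatrix K μ p *ᵥ x = q :=
  (mulVec_surjective_iff_isUnit.2 hA) q

lemma sum_mul_mulVec_of_critMatrix_mulVec_eq (hμ : IsStationaryDist K μ)
    (hcrit : ∑ i, μ i * p i = 1 / 2) {x q : n → ℝ} (hx : critMatrix K μ p *ᵥ x = q) :
    ∑ i, μ i * (1 - p i) * (K *ᵥ x) i = ∑ i, μ i * q i := by
  have hhalf := hμ.sum_mul_one_sub hcrit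
  rw [← hx, critMatrix_mulVec]
  set s := ∑ i, μ i * (1 - p i) * (K *ᵥ x) i
  have hterm : ∀ i, μ i * (x - K *ᵥ x + (2 * s) • fun i => 1 - p i) i
      = μ i * x i - μ i * (K *ᵥ x) i + 2 * s * (μ i * (1 - p i)) := by
    intro i
    simp only [Pi.add_apply, Pi.sub_apply, Pi.smul_apply, smul_eq_mul]
    ring
  simp_rw [hterm]
  rw [Finset.sum_add_distrib, Finset.sum_sub_distrib, hμ.sum_mul_mulVec, ← Finset.mul_sum, hhalf]
  ring

lemma nuVal_eq (K : Matrix n n ℝ) (μ p : n → ℝ) :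
    nuVal K μ p = 2 + 4 * ∑ i, μ i * p i * (K *ᵥ rvec K μ p) i := by
  rw [← dotProduct_diagonal_mul_mulVec]
  rfl

lemma nuVal_pos (hK : IsStochastic K) (hμ : HasUniqueStationaryDist K μ)
    (hp : ∀ i, p i ∈ Set.Ioo (0 : ℝ) 1) (hcrit : ∑ i, μ i * p i = 1 / 2) :
    0 < nuVal K μ p := by
  have hhalf := hμ.1.sum_mul_one_sub hcrit
  have hA := isUnit_critMatrix hK hμ hcrit
  obtain ⟨x, hx⟩ := exists_critMatrix_mulVec_eq hA p
  have hβ := sum_mul_mulVec_of_critMatrix_mulVec_eq hμ.1 hcrit hx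
  have hν := nuVal_eq K μ p
  have hr := rvec_eq_of_mulVec_eq hA hx
  set r := rvec K μ p
  set y := K *ᵥ r with hy
  have hyx : ∀ i, y i = (K *ᵥ x) i - 1 := fun i => by
    rw [hy, hr, mulVec_sub, hK.mulVec_one]
    rfl
  have hry : ∀ i, r i = y i + (2 * p i - 1) := by
    intro i
    have h := congrFun hx i
    rw [critMatrix_mulVec, hβ, hcrit] at h
    simp only [Pi.add_apply, Pi.sub_apply, Pi.smul_apply, smul_eq_mul] at h
    have : r i = x i - 1 := by rw [hr]; rfl
    rw [hyx, this]
    linarith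
  have hβr : ∑ i, μ i * (1 - p i) * y i = 0 := by
    simp_rw [hyx, mul_sub _ _ (1 : ℝ), mul_one]
    rw [Finset.sum_sub_distrib, hβ, hcrit, hhalf, sub_self]
  have hjensen : ∑ i, μ i * y i ^ 2 ≤ ∑ i, μ i * r i ^ 2 := by
    rw [← hμ.1.sum_mul_mulVec fun j => r j ^ 2]
    exact Finset.sum_le_sum fun i _ =>
      mul_le_mul_of_nonneg_left (hK.sq_mulVec_le r i) (hμ.1.1.1 i)
  have hexp : ∑ i, μ i * r i ^ 2 = ∑ i, μ i * y i ^ 2 + 2 * ∑ i, μ i * p i * y i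
      - 2 * ∑ i, μ i * (1 - p i) * y i + ∑ i, μ i
      - 4 * ∑ i, μ i * (p i * (1 - p i)) := by
    simp only [Finset.mul_sum, ← Finset.sum_add_distrib, ← Finset.sum_sub_distrib]
    refine Finset.sum_congr rfl fun i _ => ?_
    rw [hry]
    ring
  have hvar : 0 < ∑ i, μ i * (p i * (1 - p i)) := by
    have hpos : ∀ i, 0 < p i * (1 - p i) := fun i => mul_pos (hp i).1 (sub_pos.2 (hp i).2)
    obtain ⟨i, hi⟩ : ∃ i, μ i ≠ 0 := by
      by_contra! h
      simpa [h] using hμ.1.1.2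
    exact Finset.sum_pos' (fun i _ => mul_nonneg (hμ.1.1.1 i) (hpos i).le)
      ⟨i, Finset.mem_univ i, mul_pos ((hμ.1.1.1 i).lt_of_ne' hi) (hpos i)⟩
  rw [hβr, hμ.1.1.2] at hexp
  rw [hν]
  linarith

/-- Solvability of the Poisson equation: every `q` differs from the constant `μ·q` by an element
of the range of `I − K`. -/
lemma exists_poisson_solution (hK : IsStochastic K) (hμ : HasUniqueStationaryDist K μ)
    (hcrit : ∑ i, μ i * p i = 1 / 2) (q : n → ℝ) :
    ∃ g : n → ℝ, q = g - K *ᵥ g + (∑ i, μ i * q i) • (1 : n → ℝ) := by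
  have hA := isUnit_critMatrix hK hμ hcrit
  obtain ⟨x, hx⟩ := exists_critMatrix_mulVec_eq hA q
  obtain ⟨x₀, hx₀⟩ := exists_critMatrix_mulVec_eq hA p
  refine ⟨x - (∑ i, μ i * q i) • x₀, ?_⟩
  have hβ := sum_mul_mulVec_of_critMatrix_mulVec_eq hμ.1 hcrit hx
  have hβ₀ := sum_mul_mulVec_of_critMatrix_mulVec_eq hμ.1 hcrit hx₀
  rw [critMatrix_mulVec, hβ] at hx
  rw [critMatrix_mulVec, hβ₀, hcrit] at hx₀
  ext i
  have h := congrFun hx i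
  have h₀ := congrFun hx₀ i
  rw [mulVec_sub, mulVec_smul]
  simp only [Pi.add_apply, Pi.sub_apply, Pi.smul_apply, smul_eq_mul, Pi.one_apply] at h h₀ ⊢
  linear_combination (∑ i, μ i * q i) * h₀ - h

lemma sum_range_pow_mulVec (hK : IsStochastic K) {g q : n → ℝ} {m : ℝ}
    (hq : q = g - K *ᵥ g + m • (1 : n → ℝ)) (k : ℕ) :
    ∑ j ∈ Finset.range k, (K ^ j) *ᵥ q = g - (K ^ k) *ᵥ g + (k * m) • (1 : n → ℝ) := by
  induction k with
  | zero => simp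
  | succ k ih =>
    rw [Finset.sum_range_succ, ih, hq, mulVec_add, mulVec_sub, mulVec_smul, hK.pow_mulVec_one,
      mulVec_mulVec, ← pow_succ, Nat.cast_succ, add_one_mul, add_smul]
    abel

lemma tendsto_sum_dotProduct_pow_mulVec_atTop (hK : IsStochastic K)
    (hμ : HasUniqueStationaryDist K μ) (hcrit : ∑ i, μ i * p i = 1 / 2) {η q : n → ℝ}
    (hη : IsProbVec η) (hq : 0 < ∑ i, μ i * q i) :
    Tendsto (fun k : ℕ => ∑ j ∈ Finset.range k, η ⬝ᵥ ((K ^ j) *ᵥ q)) atTop atTop := by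
  obtain ⟨g, hg⟩ := exists_poisson_solution hK hμ hcrit q
  set m := ∑ i, μ i * q i
  have hlow : ∀ k : ℕ, k * m - 2 * ‖g‖ ≤ ∑ j ∈ Finset.range k, η ⬝ᵥ ((K ^ j) *ᵥ q) := by
    intro k
    rw [← dotProduct_sum, sum_range_pow_mulVec hK hg k]
    calc k * m - 2 * ‖g‖ = ∑ i, η i * (k * m - 2 * ‖g‖) := by
          rw [← Finset.sum_mul, hη.2, one_mul]
      _ ≤ _ := by
          refine Finset.sum_le_sum fun i _ => mul_le_mul_of_nonneg_left ?_ (hη.1 i)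
          have h1 := (abs_le.1 (norm_le_pi_norm g i)).1
          have h2 := (abs_le.1 (hK.abs_pow_mulVec_le (fun i => norm_le_pi_norm g i) k i)).2
          simp only [Pi.add_apply, Pi.sub_apply, Pi.smul_apply, smul_eq_mul, Pi.one_apply]
          linarith
  refine tendsto_atTop_mono hlow ?_
  exact tendsto_atTop_add_const_right _ _ (tendsto_natCast_atTop_atTop.atTop_mul_const hq)

end CritMatrix

section PowerSeries

variable {c : ℕ → ℝ} {M : ℝ}

lemma summable_one_sub_pow_mul (hc0 : ∀ j, 0 ≤ c j) (hcM : ∀ j, c j ≤ M) {ε : ℝ}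
    (hε : ε ∈ Set.Ioc (0 : ℝ) 1) : Summable fun j : ℕ => (1 - ε) ^ (j + 1) * c j := by
  have h0 : 0 ≤ 1 - ε := sub_nonneg.2 hε.2
  refine Summable.of_nonneg_of_le (fun j => mul_nonneg (pow_nonneg h0 _) (hc0 j))
    (fun j => mul_le_mul_of_nonneg_left (hcM j) (pow_nonneg h0 _)) ?_
  exact ((summable_nat_add_iff 1).2
    (summable_geometric_of_lt_one h0 (sub_lt_self 1 hε.1))).mul_right M

lemma strictAntiOn_tsum_one_sub_pow (hc0 : ∀ j, 0 ≤ c j) (hcM : ∀ j, c j ≤ M) {k : ℕ}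
    (hk : 0 < c k) :
    StrictAntiOn (fun ε : ℝ => ∑' j : ℕ, (1 - ε) ^ (j + 1) * c j) (Set.Ioc (0 : ℝ) 1) := by
  intro a ha b hb hab
  have h0 : 0 ≤ 1 - b := sub_nonneg.2 hb.2
  have hlt : 1 - b < 1 - a := sub_lt_sub_left hab 1
  refine Summable.tsum_lt_tsum (i := k)
    (fun j => mul_le_mul_of_nonneg_right (pow_le_pow_left₀ h0 hlt.le _) (hc0 j))
    (mul_lt_mul_of_pos_right (pow_lt_pow_left₀ hlt h0 k.succ_ne_zero) hk)
    (summable_one_sub_pow_mul hc0 hcM hb) (summable_one_sub_pow_mul hc0 hcM ha)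

lemma continuousOn_tsum_one_sub_pow (hc0 : ∀ j, 0 ≤ c j) (hcM : ∀ j, c j ≤ M) :
    ContinuousOn (fun ε : ℝ => ∑' j : ℕ, (1 - ε) ^ (j + 1) * c j) (Set.Ioc (0 : ℝ) 1) := by
  intro a ha
  have ha2 : a / 2 ∈ Set.Ioc (0 : ℝ) 1 := ⟨half_pos ha.1, by linarith [ha.1, ha.2]⟩
  have hcont : ContinuousOn (fun ε : ℝ => ∑' j : ℕ, (1 - ε) ^ (j + 1) * c j)
      (Set.Icc (a / 2) 1) := by
    refine continuousOn_tsum (fun j => by fun_prop) (summable_one_sub_pow_mul hc0 hcM ha2) ?_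
    intro j ε hε
    have h0 : 0 ≤ 1 - ε := sub_nonneg.2 hε.2
    rw [Real.norm_of_nonneg (mul_nonneg (pow_nonneg h0 _) (hc0 j))]
    exact mul_le_mul_of_nonneg_right (pow_le_pow_left₀ h0 (sub_le_sub_left hε.1 1) _) (hc0 j)
  refine (hcont a ⟨half_le_self ha.1.le, ha.2⟩).mono_of_mem_nhdsWithin ?_
  filter_upwards [self_mem_nhdsWithin,
    mem_nhdsWithin_of_mem_nhds (Ioi_mem_nhds (half_lt_self ha.1))] with ε h1 h2
  exact ⟨h2.le, h1.2⟩

lemma tendsto_tsum_one_sub_pow_atTop (hc0 : ∀ j, 0 ≤ c j) (hcM : ∀ j, c j ≤ M)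
    (hdiv : Tendsto (fun k : ℕ => ∑ j ∈ Finset.range k, c j) atTop atTop) :
    Tendsto (fun ε : ℝ => ∑' j : ℕ, (1 - ε) ^ (j + 1) * c j) (nhdsWithin 0 (Set.Ioi 0))
      atTop := by
  refine tendsto_atTop.2 fun B => ?_
  obtain ⟨k, hk⟩ := (hdiv.eventually_gt_atTop B).exists
  have hcont : Continuous fun ε : ℝ => ∑ j ∈ Finset.range k, (1 - ε) ^ (j + 1) * c j := by
    fun_prop
  have hev := hcont.tendsto 0 |>.eventually_const_lt (u := B) (by simpa using hk)
  filter_upwards [mem_nhdsWithin_of_mem_nhds hev, Ioc_mem_nhdsGT one_pos] with ε h1 h2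
  refine le_trans (le_of_lt h1) ((summable_one_sub_pow_mul hc0 hcM h2).sum_le_tsum _ ?_)
  exact fun j _ => mul_nonneg (pow_nonneg (sub_nonneg.2 h2.2) _) (hc0 j)

end PowerSeries

section Coupled

variable {n : Type*} [Fintype n] [DecidableEq n] {K : Matrix n n ℝ} {μ p₀ p₁ : n → ℝ} {ε : ℝ}

lemma critMatrix_fromBlocks (K : Matrix n n ℝ) (μ p₀ p₁ : n → ℝ) (ε : ℝ) :
    ∃ B : Matrix n n ℝ,
      critMatrix (Matrix.fromBlocks ((1 - ε) • K) (ε • K) 0 K) (Sum.elim (0 : n → ℝ) μ)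
        (Sum.elim p₁ p₀) = Matrix.fromBlocks (1 - (1 - ε) • K) B 0 (critMatrix K μ p₀) := by
  refine ⟨(critMatrix (Matrix.fromBlocks ((1 - ε) • K) (ε • K) 0 K) (Sum.elim (0 : n → ℝ) μ)
    (Sum.elim p₁ p₀)).toBlocks₁₂, ?_⟩
  ext (i | i) (j | j)
  · simp [critMatrix, vecMulVec_apply, vecMul, dotProduct, Fintype.sum_sum_type, Matrix.one_apply]
  · rfl
  · simp [critMatrix, vecMulVec_apply, vecMul, dotProduct, Fintype.sum_sum_type]
  · simp [critMatrix, vecMulVec_apply, vecMul, dotProduct, Fintype.sum_sum_type, Matrix.one_apply]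

/-- The vector `𝐫` of the coupled environment, in terms of the resolvent of `K`. -/
lemma rvec_fromBlocks (hK : IsStochastic K) (hμ : HasUniqueStationaryDist K μ)
    (hcrit : ∑ i, μ i * p₀ i = 1 / 2) (hε : ε ∈ Set.Ioc (0 : ℝ) 1) :
    rvec (Matrix.fromBlocks ((1 - ε) • K) (ε • K) 0 K) (Sum.elim (0 : n → ℝ) μ)
        (Sum.elim p₁ p₀) =
      Sum.elim (rvec K μ p₀ +
        (2 : ℝ) • fun i => ∑' j : ℕ, (1 - ε) ^ j * ((K ^ j) *ᵥ (p₁ - p₀)) i)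
        (rvec K μ p₀) := by
  have h0 : 0 ≤ 1 - ε := sub_nonneg.2 hε.2
  have h1 : 1 - ε < 1 := sub_lt_self 1 hε.1
  have hA := isUnit_critMatrix hK hμ hcrit
  obtain ⟨x, hx⟩ := exists_critMatrix_mulVec_eq hA p₀
  have hβ := sum_mul_mulVec_of_critMatrix_mulVec_eq hμ.1 hcrit hx
  have hres := hK.resolvent_eq h0 h1 (p₁ - p₀)
  set y : n → ℝ := fun i => ∑' j : ℕ, (1 - ε) ^ j * ((K ^ j) *ᵥ (p₁ - p₀)) i
  have hunit : IsUnit (critMatrix (Matrix.fromBlocks ((1 - ε) • K) (ε • K) 0 K)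
      (Sum.elim (0 : n → ℝ) μ) (Sum.elim p₁ p₀)) := by
    obtain ⟨B, hB⟩ := critMatrix_fromBlocks K μ p₀ p₁ ε
    rw [hB, Matrix.isUnit_iff_isUnit_det, det_fromBlocks_zero₂₁]
    exact (hK.det_one_sub_smul_ne_zero h0 h1).isUnit.mul ((Matrix.isUnit_iff_isUnit_det _).1 hA)
  have hsol : critMatrix (Matrix.fromBlocks ((1 - ε) • K) (ε • K) 0 K)
      (Sum.elim (0 : n → ℝ) μ) (Sum.elim p₁ p₀) *ᵥ Sum.elim (x + (2 : ℝ) • y) x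
      = Sum.elim p₁ p₀ := by
    rw [critMatrix_mulVec, hβ, hcrit] at hx
    rw [critMatrix_mulVec, fromBlocks_mulVec]
    simp only [Sum.elim_comp_inl, Sum.elim_comp_inr, Fintype.sum_sum_type, Sum.elim_inl,
      Sum.elim_inr, Pi.zero_apply, zero_mul, Finset.sum_const_zero, zero_add, zero_mulVec, hβ,
      hcrit]
    ext (i | i)
    · have hxi := congrFun hx i
      have hyi := congrFun hres i
      rw [sub_mulVec, one_mulVec] at hyi
      simp only [Pi.add_apply, Pi.sub_apply, Pi.smul_apply, smul_eq_mul, Sum.elim_inl,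
        smul_mulVec, mulVec_add, mulVec_smul] at hxi hyi ⊢
      linear_combination hxi + 2 * hyi
    · simpa using congrFun hx i
  rw [rvec_eq_of_mulVec_eq hunit hsol, rvec_eq_of_mulVec_eq hA hx]
  ext (i | i)
  · simp only [Pi.sub_apply, Pi.add_apply, Pi.one_apply, Sum.elim_inl]
    ring
  · rfl

lemma nuVal_fromBlocks (hK : IsStochastic K) (hμ : HasUniqueStationaryDist K μ)
    (hcrit : ∑ i, μ i * p₀ i = 1 / 2) (hε : ε ∈ Set.Ioc (0 : ℝ) 1) :
    nuVal (Matrix.fromBlocks ((1 - ε) • K) (ε • K) 0 K) (Sum.elim (0 : n → ℝ) μ)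
      (Sum.elim p₁ p₀) = nuVal K μ p₀ := by
  rw [nuVal_eq, nuVal_eq, rvec_fromBlocks hK hμ hcrit hε, fromBlocks_mulVec]
  simp [Fintype.sum_sum_type]

end Coupled

/-- **Lemma 5.1.** Let `p₀ ≤ p₁` pointwise with `μ·𝐩₁ > μ·𝐩₀ = 1/2`. Then for every
`ε ∈ (0,1]`,
`δ̂_ε = δ(𝐩₀,K,η) + 4 η·(Σ_{j≥1} (1−ε)^j K^{j−1}(𝐩₁−𝐩₀)) / ν(𝐩₀,K)`.
In particular `ε ↦ δ̂_ε` is continuous and strictly decreasing on `(0,1]`, equals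
`δ(𝐩₀,K,η)` at `ε = 1`, and tends to `+∞` as `ε ↓ 0`. -/
theorem deltaHat_formula
    {N : ℕ} (K : Matrix (Fin N) (Fin N) ℝ) (μ p₀ p₁ η : Fin N → ℝ)
    (hK : IsStochastic K) (hμ : HasUniqueStationaryDist K μ)
    (hp₀ : ∀ i, p₀ i ∈ Set.Ioo (0 : ℝ) 1) (hp₁ : ∀ i, p₁ i ∈ Set.Ioo (0 : ℝ) 1)
    (hle : ∀ i, p₀ i ≤ p₁ i)
    (hcrit : ∑ i, μ i * p₀ i = 1 / 2) (hsup : 1 / 2 < ∑ i, μ i * p₁ i)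
    (hη : IsProbVec η) :
    (∀ ε : ℝ, ε ∈ Set.Ioc (0 : ℝ) 1 →
      deltaHat K μ p₀ p₁ η ε =
        deltaVal K μ p₀ η +
          4 * (∑ i, η i *
              ∑' j : ℕ, (1 - ε) ^ (j + 1) * Matrix.mulVec (K ^ j) (p₁ - p₀) i) /
            nuVal K μ p₀) ∧
    StrictAntiOn (deltaHat K μ p₀ p₁ η) (Set.Ioc (0 : ℝ) 1) ∧
    ContinuousOn (deltaHat K μ p₀ p₁ η) (Set.Ioc (0 : ℝ) 1) ∧
    deltaHat K μ p₀ p₁ η 1 = deltaVal K μ p₀ η ∧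
    Tendsto (deltaHat K μ p₀ p₁ η) (nhdsWithin 0 (Set.Ioi 0)) atTop := by
  set q := p₁ - p₀ with hq
  have hν := nuVal_pos hK hμ hp₀ hcrit
  have hq0 : ∀ i, 0 ≤ q i := fun i => sub_nonneg.2 (hle i)
  have hqμ : 0 < ∑ i, μ i * q i := by
    simp only [hq, Pi.sub_apply, mul_sub, Finset.sum_sub_distrib, hcrit]
    linarith
  set c : ℕ → ℝ := fun j => η ⬝ᵥ ((K ^ j) *ᵥ q) with hc
  have hc0 : ∀ j, 0 ≤ c j := fun j =>
    Finset.sum_nonneg fun i _ => mul_nonneg (hη.1 i) (hK.pow_mulVec_nonneg hq0 j i)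
  have hcM : ∀ j, c j ≤ ‖q‖ := fun j => by
    calc c j ≤ ∑ i, η i * ‖q‖ := Finset.sum_le_sum fun i _ => mul_le_mul_of_nonneg_left
          (abs_le.1 (hK.abs_pow_mulVec_le (fun i => norm_le_pi_norm q i) j i)).2 (hη.1 i)
      _ = ‖q‖ := by rw [← Finset.sum_mul, hη.2, one_mul]
  have hdiv : Tendsto (fun k : ℕ => ∑ j ∈ Finset.range k, c j) atTop atTop :=
    tendsto_sum_dotProduct_pow_mulVec_atTop hK hμ hcrit hη hqμ
  obtain ⟨k, hk⟩ : ∃ k, 0 < c k := by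
    obtain ⟨m, hm⟩ := (hdiv.eventually_gt_atTop 0).exists
    obtain ⟨k, -, hk⟩ := Finset.exists_lt_of_sum_lt (f := fun _ => (0 : ℝ)) (by simpa using hm)
    exact ⟨k, hk⟩
  have hformula : ∀ ε : ℝ, ε ∈ Set.Ioc (0 : ℝ) 1 → deltaHat K μ p₀ p₁ η ε =
      deltaVal K μ p₀ η + 4 * (∑ i, η i *
        ∑' j : ℕ, (1 - ε) ^ (j + 1) * Matrix.mulVec (K ^ j) q i) / nuVal K μ p₀ := by
    intro ε hε
    rw [deltaHat, deltaVal, deltaVal, nuVal_fromBlocks hK hμ hcrit hε,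
      rvec_fromBlocks hK hμ hcrit hε, ← add_div]
    congr 1
    simp only [Fintype.sum_sum_type, Sum.elim_inl, Sum.elim_inr, Pi.smul_apply, Pi.add_apply,
      smul_eq_mul, pow_succ', mul_assoc, tsum_mul_left, Finset.mul_sum,
      ← Finset.sum_add_distrib]
    refine Finset.sum_congr rfl fun i _ => ?_
    ring
  have hseries : ∀ ε : ℝ, ε ∈ Set.Ioc (0 : ℝ) 1 → deltaHat K μ p₀ p₁ η ε =
      deltaVal K μ p₀ η + 4 / nuVal K μ p₀ * ∑' j : ℕ, (1 - ε) ^ (j + 1) * c j := by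
    intro ε hε
    have hsum : ∀ i, Summable fun j : ℕ => (1 - ε) ^ (j + 1) * Matrix.mulVec (K ^ j) q i := by
      intro i
      simpa only [pow_succ', mul_assoc] using (hK.summable_resolvent (sub_nonneg.2 hε.2)
        (sub_lt_self 1 hε.1) q i).mul_left (1 - ε)
    rw [hformula ε hε, mul_div_right_comm]
    simp_rw [← tsum_mul_left (a := η _)]
    rw [← Summable.tsum_finsetSum fun i _ => (hsum i).mul_left _]
    simp only [hc, dotProduct, Finset.mul_sum, mul_left_comm]
  have h4 : 0 < 4 / nuVal K μ p₀ := by positivity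
  refine ⟨hformula, ?_, ?_, ?_, ?_⟩
  · intro a ha b hb hab
    rw [hseries a ha, hseries b hb]
    have := strictAntiOn_tsum_one_sub_pow hc0 hcM hk ha hb hab
    gcongr
  · exact ContinuousOn.congr (continuousOn_const.add
      (continuousOn_const.mul (continuousOn_tsum_one_sub_pow hc0 hcM))) hseries
  · simp [hseries 1 ⟨one_pos, le_rfl⟩]
  · refine Tendsto.congr' ?_ (tendsto_atTop_add_const_left _ (deltaVal K μ p₀ η)
      ((tendsto_tsum_one_sub_pow_atTop hc0 hcM hdiv).const_mul_atTop h4))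
    filter_upwards [Ioc_mem_nhdsGT one_pos] with ε hε
    exact (hseries ε hε).symm

end
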